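/- Let d ≥ 1, let P be a finite nonempty subset of ℝ^d satisfying Condition 1, let ε ∈ (0,1), and let Q ⊆ P be a nonempty ε-regret set of P. Then Q is an ε-kernel of P: for every unit vector x ∈ ℝ^d, w(x,Q) ≥ (1−ε)·w(x,P), where the directional width is w(x,S) = max_{p ∈ S} ⟨p,x⟩ − min_{q ∈ S} ⟨q,x⟩. -/

import Mathlib

open scoped RealInnerProductSpace

/-- If `P ⊆ ℝ^d` is finite nonempty satisfying Condition 1 and
`Q ⊆ P` is a nonempty `ε`-regret set of `P`, then `Q` is an `ε`-kernel of `P`: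
for every unit vector `x`, `w(x,Q) ≥ (1−ε)·w(x,P)`, where
`w(x,S) = max_{p∈S} ⟪p,x⟫ − min_{q∈S} ⟪q,x⟫`. -/
theorem stmt1 (d : ℕ) (hd : 1 ≤ d)
    (P Q : Finset (EuclideanSpace ℝ (Fin d)))
    (hP : P.Nonempty) (hQ : Q.Nonempty) (hQP : Q ⊆ P)
    (ε : ℝ) (hε : ε ∈ Set.Ioo (0 : ℝ) 1)
    (cond1 : ∀ x : EuclideanSpace ℝ (Fin d), ‖x‖ = 1 →
      0 < P.sup' hP (fun p => ⟪p, x⟫))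
    (regret : ∀ x : EuclideanSpace ℝ (Fin d), ‖x‖ = 1 →
      (1 - ε) * P.sup' hP (fun p => ⟪p, x⟫) ≤ Q.sup' hQ (fun p => ⟪p, x⟫)) :
    ∀ x : EuclideanSpace ℝ (Fin d), ‖x‖ = 1 →
      (1 - ε) * (P.sup' hP (fun p => ⟪p, x⟫) - P.inf' hP (fun p => ⟪p, x⟫)) ≤
        Q.sup' hQ (fun p => ⟪p, x⟫) - Q.inf' hQ (fun p => ⟪p, x⟫) := by
  intro x hx
  have hneg (S : Finset (EuclideanSpace ℝ (Fin d))) (hS : S.Nonempty) :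
      S.sup' hS (fun p => ⟪p, -x⟫) = -S.inf' hS (fun p => ⟪p, x⟫) := by
    apply le_antisymm
    · refine Finset.sup'_le hS _ fun p hp => ?_
      rw [inner_neg_right]
      exact neg_le_neg (Finset.inf'_le (fun p => ⟪p, x⟫) hp)
    · obtain ⟨p, hp, hinf⟩ := Finset.exists_mem_eq_inf' hS (fun p => ⟪p, x⟫)
      rw [hinf, ← inner_neg_right]
      exact Finset.le_sup' (fun p => ⟪p, -x⟫) hp
  have hmax := regret x hx
  have hmin := regret (-x) (by rwa [norm_neg])
  rw [hneg P hP, hneg Q hQ] at hmin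
  linarith
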